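/- If the complement Ḡ of a simple graph G on n ≥ 3 vertices has a connected component that is a complete graph with at least two vertices, then G is not ensnaring. -/

import Mathlib

open scoped Classical

/-- The state space `Ξₙ` for a graph on vertex set `V` with `n = |V|`: a state `(v, i, ε)`
consists of a bijection `v` from the vertices to the positions `ℤ/n` (the replica of vertex
`a` sits at position `v a`; positions increase clockwise), the index `i : ℤ/n`, and the
orientation `ε ∈ {±1}` encoded as a `Bool` (`true` = `+1`, `false` = `-1`). -/
abbrev Xi (V : Type*) [Fintype V] : Type _ :=
  (V ≃ ZMod (Fintype.card V)) × ZMod (Fintype.card V) × Bool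

/-- The orientation `ε` as an element of `ℤ/n`. -/
def epsZ (n : ℕ) (e : Bool) : ZMod n := if e then 1 else -1

/-- Refractive toric promotion `Θ_G`:
`Θ_G (v,i,ε) = (s̄ᵢ v, i+ε, ε)` if `{v⁻¹(i), v⁻¹(i+1)}` is not an edge of `G`, and
`Θ_G (v,i,ε) = (s̄ᵢ v, i−ε, −ε)` if it is an edge of `G`.  Here `s̄ᵢ v` swaps the replicas
sitting at positions `i` and `i+1`. -/
noncomputable def theta {V : Type*} [Fintype V] (G : SimpleGraph V) (D : Xi V) : Xi V :=
  if G.Adj (D.1.symm D.2.1) (D.1.symm (D.2.1 + 1)) then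
    (D.1.trans (Equiv.swap D.2.1 (D.2.1 + 1)), D.2.1 - epsZ _ D.2.2, !D.2.2)
  else
    (D.1.trans (Equiv.swap D.2.1 (D.2.1 + 1)), D.2.1 + epsZ _ D.2.2, D.2.2)

/-- The net number of clockwise steps that the replica of vertex `a` makes during one
application of `Θ_G` to the state `D`: each application swaps the replicas at positions
`i` and `i+1`, moving the former one step clockwise and the latter one step
counterclockwise. -/
def disp {V : Type*} [Fintype V] (D : Xi V) (a : V) : ℤ :=
  if D.1 a = D.2.1 then 1 else if D.1 a = D.2.1 + 1 then -1 else 0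

/-- `n` times the winding number `w_O(a)` of vertex `a` with respect to the orbit `O` of the
state `D` under `Θ_G`: the net number of clockwise steps made by the replica of `a` during
`P` consecutive applications of `Θ_G` starting from `D`, where `P` is the size of the orbit
(i.e. the minimal period of `D`).  The winding number itself is `windSum G D a / n`; in
particular `w_O(a) = 0` iff `windSum G D a = 0`, and `w_O(a) = w_O(b)` iff
`windSum G D a = windSum G D b`. -/
noncomputable def windSum {V : Type*} [Fintype V] (G : SimpleGraph V) (D : Xi V) (a : V) : ℤ :=
  ∑ k ∈ Finset.range (Function.minimalPeriod (theta G) D), disp ((theta G)^[k] D) a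

/-- The winding vector of the orbit of `D` under `Θ_G` is zero. -/
def WindingVectorZero {V : Type*} [Fintype V] (G : SimpleGraph V) (D : Xi V) : Prop :=
  ∀ a : V, windSum G D a = 0

/-- `G` is ensnaring if every orbit of `Θ_G` has winding vector `0`. -/
def Ensnaring {V : Type*} [Fintype V] (G : SimpleGraph V) : Prop :=
  ∀ D : Xi V, WindingVectorZero G D

/-- `G` is expelling if no orbit of `Θ_G` has winding vector `0`. -/
def Expelling {V : Type*} [Fintype V] (G : SimpleGraph V) : Prop :=
  ∀ D : Xi V, ¬ WindingVectorZero G D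

section aux
variable {V : Type*} [Fintype V]

lemma aux_theta_fst (G : SimpleGraph V) (D : Xi V) :
    (theta G D).1 = D.1.trans (Equiv.swap D.2.1 (D.2.1 + 1)) := by
  unfold theta; split_ifs <;> rfl

lemma aux_theta_idx (G : SimpleGraph V) (D : Xi V) :
    (theta G D).2.1 - epsZ _ (theta G D).2.2 = D.2.1 := by
  unfold theta; split_ifs
  · rcases D with ⟨v, i, e⟩
    cases e <;> simp [epsZ]
  · simp

lemma aux_theta_inj (G : SimpleGraph V) : Function.Injective (theta G) := by
  intro D D' h
  have hi : D.2.1 = D'.2.1 := by rw [← aux_theta_idx G D, h, aux_theta_idx]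
  have hv : D.1 = D'.1 := by
    have h1 := aux_theta_fst G D
    rw [h, aux_theta_fst G D', hi] at h1
    ext a
    have := congrArg (fun e => e a) h1
    simpa using this.symm
  have h2 : (theta G D).2.2 = (theta G D').2.2 := by rw [h]
  have he : D.2.2 = D'.2.2 := by
    unfold theta at h2
    rw [hi, hv] at h2
    split_ifs at h2
    · simpa using h2
    · simpa using h2
  exact Prod.ext hv (Prod.ext hi he)

lemma aux_disp (hn : 3 ≤ Fintype.card V) (D : Xi V) (a : V) :
    disp D a = (if a = D.1.symm D.2.1 then 1 else 0)
      - (if a = D.1.symm (D.2.1 + 1) then 1 else 0) := by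
  haveI : Fact (1 < Fintype.card V) := ⟨by omega⟩
  have h : D.2.1 ≠ D.2.1 + 1 := by simp
  unfold disp
  simp only [Equiv.eq_symm_apply]
  split_ifs <;> simp_all

/-- The invariant. -/
def AuxInv (K : Finset V) (D : Xi V) : Prop :=
  (D.2.2 = true ∧ D.1.symm D.2.1 ∈ K ∧
    (D.1.symm (D.2.1 + 1) ∈ K ∨ D.1.symm (D.2.1 - 1) ∈ K)) ∨
  (D.2.2 = false ∧ D.1.symm D.2.1 ∈ K ∧ D.1.symm (D.2.1 + 1) ∉ K ∧
    D.1.symm (D.2.1 + 2) ∈ K)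

lemma aux_two_ne (hn : 3 ≤ Fintype.card V) : (2 : ZMod (Fintype.card V)) ≠ 0 := by
  intro h
  have : ((2 : ℕ) : ZMod (Fintype.card V)) = 0 := by exact_mod_cast h
  rw [ZMod.natCast_eq_zero_iff] at this
  have := Nat.le_of_dvd (by norm_num) this
  omega

lemma aux_inv_step (hn : 3 ≤ Fintype.card V) (G : SimpleGraph V) (K : Finset V)
    (h1 : ∀ a ∈ K, ∀ b ∈ K, ¬ G.Adj a b) (h2 : ∀ a ∈ K, ∀ b ∉ K, G.Adj a b)
    (D : Xi V) (hD : AuxInv K D) : AuxInv K (theta G D) := by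
  haveI : Fact (1 < Fintype.card V) := ⟨by omega⟩
  have t2 := aux_two_ne hn
  obtain ⟨v, i, e⟩ := D
  have n1 : i - 1 ≠ i := by simp
  have n2 : i - 1 ≠ i + 1 := by
    intro h; apply t2; linear_combination -h
  have n3 : i + 2 ≠ i := by simpa using t2
  have n4 : i + 2 ≠ i + 1 := by
    intro h; exact one_ne_zero (α := ZMod (Fintype.card V)) (by linear_combination h)
  rcases hD with ⟨he, hp, hq⟩ | ⟨he, hp, hq, hr⟩
  · simp only at he hp hq
    subst he
    by_cases hqK : v.symm (i + 1) ∈ K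
    · have := h1 _ hp _ hqK
      left
      simp [theta, this, epsZ, hp, hqK]
    · have hadj := h2 _ hp _ hqK
      have hq' := hq.resolve_left hqK
      right
      have e1 : i - 1 + 2 = i + 1 := by ring
      simp [theta, hadj, epsZ, hp, hqK, e1, Equiv.swap_apply_of_ne_of_ne n1 n2, hq']
  · simp only at he hp hq hr
    subst he
    have hadj := h2 _ hp _ hq
    left
    have e1 : i + 1 + 1 = i + 2 := by ring
    simp [theta, hadj, epsZ, hp, e1, Equiv.swap_apply_of_ne_of_ne n3 n4, hr]

lemma aux_S (hn : 3 ≤ Fintype.card V) (K : Finset V) (D : Xi V) :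
    ∑ a ∈ K, disp D a = (if D.1.symm D.2.1 ∈ K then 1 else 0)
      - (if D.1.symm (D.2.1 + 1) ∈ K then 1 else 0) := by
  simp only [aux_disp hn, Finset.sum_sub_distrib, Finset.sum_ite_eq']

lemma aux_main (hn : 3 ≤ Fintype.card V) (G : SimpleGraph V) (K : Finset V)
    (h1 : ∀ a ∈ K, ∀ b ∈ K, ¬ G.Adj a b) (h2 : ∀ a ∈ K, ∀ b ∉ K, G.Adj a b)
    (a b : V) (hab : a ≠ b) (ha : a ∈ K) (hb : b ∈ K) : ¬ Ensnaring G := by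
  haveI : Fact (1 < Fintype.card V) := ⟨by omega⟩
  haveI : NeZero (Fintype.card V) := ⟨by omega⟩
  intro hE
  obtain ⟨D, hD⟩ : ∃ D : Xi V, AuxInv K D := by
    have hc : Fintype.card V = Fintype.card (ZMod (Fintype.card V)) := by
      rw [ZMod.card]
    let e : V ≃ ZMod (Fintype.card V) := Fintype.equivOfCardEq hc
    let f := e.trans (Equiv.swap (e a) 0)
    have fa : f a = 0 := by simp [f]
    have fb : f b ≠ 0 := by rw [← fa]; exact fun h => hab (f.injective h).symm
    let g := f.trans (Equiv.swap (f b) 1)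
    have ga : g a = 0 := by
      simp only [g, Equiv.trans_apply, fa]
      exact Equiv.swap_apply_of_ne_of_ne fb.symm zero_ne_one
    have gb : g b = 1 := by simp [g]
    refine ⟨(g, 0, true), Or.inl ⟨rfl, ?_, Or.inl ?_⟩⟩
    · simpa [← ga] using ha
    · simpa [← gb] using hb
  have hI : ∀ k, AuxInv K ((theta G)^[k] D) := by
    intro k
    induction k with
    | zero => exact hD
    | succ k ih => rw [Function.iterate_succ_apply']; exact aux_inv_step hn G K h1 h2 _ ih
  have hnn : ∀ k, 0 ≤ ∑ a ∈ K, disp ((theta G)^[k] D) a := by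
    intro k
    rw [aux_S hn]
    have : ((theta G)^[k] D).1.symm ((theta G)^[k] D).2.1 ∈ K := by
      rcases hI k with h | h <;> exact h.2.1
    rw [if_pos this]
    split_ifs <;> simp
  set P := Function.minimalPeriod (theta G) D with hP
  have hPpos : 0 < P :=
    Function.minimalPeriod_pos_of_mem_periodicPts
      ((aux_theta_inj G).mem_periodicPts D)
  have hsum : ∑ k ∈ Finset.range P, ∑ a ∈ K, disp ((theta G)^[k] D) a = 0 := by
    rw [Finset.sum_comm]
    exact Finset.sum_eq_zero (fun a _ => hE D a)
  have hz := (Finset.sum_eq_zero_iff_of_nonneg (fun k _ => hnn k)).1 hsum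
  have hgood : ∀ k < P, ((theta G)^[k] D).2.2 = true ∧
      ((theta G)^[k] D).1.symm ((theta G)^[k] D).2.1 ∈ K ∧
      ((theta G)^[k] D).1.symm (((theta G)^[k] D).2.1 + 1) ∈ K := by
    intro k hk
    have h := hz k (Finset.mem_range.2 hk)
    rw [aux_S hn] at h
    rcases hI k with h' | h'
    · rw [if_pos h'.2.1] at h
      refine ⟨h'.1, h'.2.1, ?_⟩
      by_contra hc
      rw [if_neg hc] at h
      simp at h
    · rw [if_pos h'.2.1, if_neg h'.2.2.1] at h
      simp at h
  set x := D.1.symm D.2.1 with hx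
  have hcar : ∀ k < P, ((theta G)^[k] D).1 x = ((theta G)^[k] D).2.1 := by
    intro k
    induction k with
    | zero => intro _; simp [hx]
    | succ k ih =>
      intro hk
      have ih := ih (by omega)
      obtain ⟨g1, g2, g3⟩ := hgood k (by omega)
      rw [Function.iterate_succ_apply']
      generalize (theta G)^[k] D = E at *
      have := h1 _ g2 _ g3
      simp [theta, this, g1, epsZ, ih]
  have hw : windSum G D x = P := by
    unfold windSum
    rw [Finset.sum_congr rfl (g := fun _ => (1 : ℤ))]
    · simp [hP]
    · intro k hk
      have := hcar k (Finset.mem_range.1 hk)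
      simp [disp, this]
  have := hE D x
  omega

end aux

/-- If the complement `Ḡ` of a graph `G` on `n ≥ 3` vertices has a
connected component that is complete (any two of its vertices are adjacent in `Ḡ`) and has
at least two vertices, then `G` is not ensnaring. -/
theorem stmt_16 (n : ℕ) (hn : 3 ≤ n) (G : SimpleGraph (Fin n))
    (C : Gᶜ.ConnectedComponent)
    (hcomplete : ∀ a b : Fin n, Gᶜ.connectedComponentMk a = C →
      Gᶜ.connectedComponentMk b = C → a ≠ b → Gᶜ.Adj a b)
    (htwo : ∃ a b : Fin n, a ≠ b ∧ Gᶜ.connectedComponentMk a = C ∧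
      Gᶜ.connectedComponentMk b = C) :
    ¬ Ensnaring G := by
  obtain ⟨a, b, hab, ha, hb⟩ := htwo
  refine aux_main (by simpa using hn) G
    (Finset.univ.filter (fun a => Gᶜ.connectedComponentMk a = C)) ?_ ?_ a b hab
    (by simpa using ha) (by simpa using hb)
  · intro x hx y hy hadj
    simp only [Finset.mem_filter, Finset.mem_univ, true_and] at hx hy
    have := hcomplete x y hx hy hadj.ne
    exact ((SimpleGraph.compl_adj _ _ _).1 this).2 hadj
  · intro x hx y hy
    simp only [Finset.mem_filter, Finset.mem_univ, true_and] at hx hy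
    by_contra hadj
    have hne : x ≠ y := by rintro rfl; exact hy hx
    have h : Gᶜ.Adj x y := (SimpleGraph.compl_adj _ _ _).2 ⟨hne, hadj⟩
    exact hy ((SimpleGraph.ConnectedComponent.sound h.reachable).symm.trans hx)
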